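/- Under the setting of the previous result (x̃ solves dx̃/dλ = F(λ)x̃ on [0,1] with x̃(0)=x̃₀, M(λ) = -((α+β)A₀ + βA_h) invertible, F defined from M, A_h, Q as stated, and M(λ) ≥ M₀ > 0 for a constant symmetric positive definite matrix M₀), assume additionally that Q is a constant symmetric positive definite matrix. Then x̃(λ)ᵀ M₀ x̃(λ) ≤ c·e^{-rλ} for all λ ∈ [0,1], where c = x̃₀ᵀ M(0) x̃₀ and r = λ_min(Q)·λ_min(M₀) > 0, with λ_min denoting the smallest eigenvalue. -/

import Mathlib

open Matrix Set

section QuadraticForms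

variable {ι : Type*} [Fintype ι]

theorem HasDerivWithinAt.dotProduct {u v : ℝ → ι → ℝ} {u' v' : ι → ℝ} {s : Set ℝ} {t : ℝ}
    (hu : HasDerivWithinAt u u' s t) (hv : HasDerivWithinAt v v' s t) :
    HasDerivWithinAt (fun y => u y ⬝ᵥ v y) (u' ⬝ᵥ v t + u t ⬝ᵥ v') s t := by
  rw [hasDerivWithinAt_pi] at hu hv
  simp only [_root_.dotProduct, ← Finset.sum_add_distrib]
  exact HasDerivWithinAt.fun_sum fun i _ => (hu i).mul (hv i)

theorem HasDerivWithinAt.mulVec_const (A : Matrix ι ι ℝ) {u : ℝ → ι → ℝ} {u' : ι → ℝ}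
    {s : Set ℝ} {t : ℝ} (hu : HasDerivWithinAt u u' s t) :
    HasDerivWithinAt (fun y => A *ᵥ u y) (A *ᵥ u') s t :=
  (A.mulVecLin.toContinuousLinearMap.hasFDerivAt (x := u t)).comp_hasDerivWithinAt t hu

theorem Matrix.IsSymm.mulVec_dotProduct {A : Matrix ι ι ℝ} (hA : A.IsSymm) (x y : ι → ℝ) :
    A *ᵥ x ⬝ᵥ y = x ⬝ᵥ A *ᵥ y := by
  rw [dotProduct_mulVec, ← mulVec_transpose, hA.eq]

theorem Matrix.IsSymm.hasDerivWithinAt_quadForm {A : Matrix ι ι ℝ} (hA : A.IsSymm)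
    {u : ℝ → ι → ℝ} {u' : ι → ℝ} {s : Set ℝ} {t : ℝ} (hu : HasDerivWithinAt u u' s t) :
    HasDerivWithinAt (fun y => u y ⬝ᵥ A *ᵥ u y) (2 * (A *ᵥ u t ⬝ᵥ u')) s t := by
  convert hu.dotProduct (hu.mulVec_const A) using 1
  rw [← hA.mulVec_dotProduct, dotProduct_comm (A *ᵥ u'), ← hA.mulVec_dotProduct, two_mul]

theorem Matrix.IsHermitian.iInf_eigenvalues_mul_le [DecidableEq ι] {A : Matrix ι ι ℝ}
    (hA : A.IsHermitian) (x : ι → ℝ) :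
    (⨅ i, hA.eigenvalues i) * (x ⬝ᵥ x) ≤ x ⬝ᵥ A *ᵥ x := by
  set μ := ⨅ i, hA.eigenvalues i
  have hB : (A - algebraMap ℝ _ μ).IsHermitian := by
    refine hA.sub ?_
    rw [Algebra.algebraMap_eq_smul_one]
    exact isHermitian_one.smul (IsSelfAdjoint.all μ)
  have hpos : (A - algebraMap ℝ _ μ).PosSemidef := by
    rw [hB.posSemidef_iff_eigenvalues_nonneg]
    intro i
    have hmem := hB.eigenvalues_mem_spectrum_real i
    rw [Pi.zero_apply]
    generalize hB.eigenvalues i = ν at *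
    rw [sub_eq_neg_add, ← spectrum.add_mem_iff, hA.spectrum_real_eq_range_eigenvalues] at hmem
    obtain ⟨j, hj⟩ := hmem
    have : μ ≤ hA.eigenvalues j := ciInf_le (Set.finite_range _).bddBelow j
    linarith
  have := hpos.dotProduct_mulVec_nonneg x
  rw [Algebra.algebraMap_eq_smul_one, sub_mulVec, smul_mulVec, one_mulVec, dotProduct_sub,
    dotProduct_smul, smul_eq_mul, star_trivial] at this
  linarith

theorem Matrix.PosDef.iInf_eigenvalues_pos [DecidableEq ι] [Nonempty ι] {A : Matrix ι ι ℝ}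
    (hA : A.PosDef) : 0 < ⨅ i, hA.1.eigenvalues i := by
  obtain ⟨i, hi⟩ := exists_eq_ciInf_of_finite (f := hA.1.eigenvalues)
  exact hi ▸ hA.eigenvalues_pos i

theorem Matrix.mul_dotProduct_mulVec_le {A : Matrix ι ι ℝ} {μ : ℝ} (hμ : 0 < μ) {x : ι → ℝ}
    (h : μ * (x ⬝ᵥ x) ≤ x ⬝ᵥ A *ᵥ x) :
    μ * (x ⬝ᵥ A *ᵥ x) ≤ A *ᵥ x ⬝ᵥ A *ᵥ x := by
  have hsq : 0 ≤ (A *ᵥ x - μ • x) ⬝ᵥ (A *ᵥ x - μ • x) :=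
    Finset.sum_nonneg fun i _ => mul_self_nonneg _
  simp only [dotProduct_sub, sub_dotProduct, dotProduct_smul, smul_dotProduct, smul_eq_mul,
    dotProduct_comm (A *ᵥ x) x] at hsq
  nlinarith

end QuadraticForms

theorem le_mul_exp_of_hasDerivWithinAt_le {V V' : ℝ → ℝ} {r : ℝ}
    (hV : ∀ l ∈ Icc (0 : ℝ) 1, HasDerivWithinAt V (V' l) (Icc 0 1) l)
    (hV' : ∀ l ∈ Icc (0 : ℝ) 1, V' l ≤ -r * V l) {l : ℝ} (hl : l ∈ Icc (0 : ℝ) 1) :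
    V l ≤ V 0 * Real.exp (-r * l) := by
  have hW : ∀ t ∈ Icc (0 : ℝ) 1, HasDerivWithinAt (fun y => V y * Real.exp (r * y))
      (V' t * Real.exp (r * t) + V t * (Real.exp (r * t) * (r * 1))) (Icc 0 1) t := fun t ht =>
    (hV t ht).mul (((hasDerivAt_id t).const_mul r).exp.hasDerivWithinAt)
  have hanti : AntitoneOn (fun y => V y * Real.exp (r * y)) (Icc (0 : ℝ) 1) := by
    refine antitoneOn_of_hasDerivWithinAt_nonpos (convex_Icc 0 1)
      (fun t ht => (hW t ht).continuousWithinAt)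
      (fun t ht => (hW t (interior_subset ht)).mono interior_subset) fun t ht => ?_
    nlinarith [hV' t (interior_subset ht), Real.exp_pos (r * t)]
  have h := hanti (left_mem_Icc.2 zero_le_one) hl hl.1
  simp only [mul_zero, Real.exp_zero, mul_one] at h
  rwa [neg_mul, Real.exp_neg, ← div_eq_mul_inv, le_div_iff₀ (Real.exp_pos _)]

/-- Paper's Theorem 2.3, part (2): under the setting of Lemma 2.2 with
`M(λ) ≥ M₀ > 0`, if moreover `Q` is a constant symmetric positive definite
matrix, then `x̃(λ)ᵀ M₀ x̃(λ) ≤ c·e^{-rλ}` on `[0,1]`, where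
`c = x̃₀ᵀ M(0) x̃₀` and `r = λ_min(Q)·λ_min(M₀) > 0`. -/
theorem particle_flow_difference_exponential_decay
    {n : ℕ} (hn : 0 < n) (α β α' β' : ℝ → ℝ)
    (hα : ∀ l ∈ Icc (0:ℝ) 1, HasDerivWithinAt α (α' l) (Icc (0:ℝ) 1) l)
    (hβ : ∀ l ∈ Icc (0:ℝ) 1, HasDerivWithinAt β (β' l) (Icc (0:ℝ) 1) l)
    (hα' : ContinuousOn α' (Icc (0:ℝ) 1))
    (hβ' : ContinuousOn β' (Icc (0:ℝ) 1))
    (hα0 : α 0 = 1) (hβ0 : β 0 = 0)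
    (hαβ : ∀ l ∈ Icc (0:ℝ) 1, α l + β l ≠ 0)
    (A₀ Ah : Matrix (Fin n) (Fin n) ℝ)
    (hA₀ : A₀.IsSymm) (hAh : Ah.IsSymm)
    (M : ℝ → Matrix (Fin n) (Fin n) ℝ)
    (hM : ∀ l, M l = -((α l + β l) • A₀ + β l • Ah))
    (hMinv : ∀ l ∈ Icc (0:ℝ) 1, IsUnit (M l))
    (Q : Matrix (Fin n) (Fin n) ℝ)
    (hQpd : Q.PosDef)
    (F : ℝ → Matrix (Fin n) (Fin n) ℝ)
    (hF : ∀ l, F l = -((1:ℝ)/2) • (Q * M l)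
      + ((α l * β' l - α' l * β l) / (2 * (α l + β l))) • ((M l)⁻¹ * Ah)
      - ((α' l + β' l) / (2 * (α l + β l))) • (1 : Matrix (Fin n) (Fin n) ℝ))
    (M₀ : Matrix (Fin n) (Fin n) ℝ) (hM₀ : M₀.PosDef)
    (hMge : ∀ l ∈ Icc (0:ℝ) 1, (M l - M₀).PosSemidef)
    (xt : ℝ → (Fin n → ℝ)) (xt₀ : Fin n → ℝ)
    (hxt0 : xt 0 = xt₀)
    (hxt : ∀ l ∈ Icc (0:ℝ) 1,
      HasDerivWithinAt xt ((F l).mulVec (xt l)) (Icc (0:ℝ) 1) l)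
    (c r : ℝ)
    (hc : c = xt₀ ⬝ᵥ (M 0).mulVec xt₀)
    (hr : r = (⨅ i, hQpd.1.eigenvalues i) * (⨅ i, hM₀.1.eigenvalues i)) :
    0 < r ∧
    ∀ l ∈ Icc (0:ℝ) 1,
      xt l ⬝ᵥ M₀.mulVec (xt l) ≤ c * Real.exp (-r * l) := by
  have : Nonempty (Fin n) := ⟨⟨0, hn⟩⟩
  have hq := hQpd.iInf_eigenvalues_pos
  have hm := hM₀.iInf_eigenvalues_pos
  refine ⟨hr ▸ mul_pos hq hm, fun l hl => ?_⟩
  have hM₀le : ∀ t ∈ Icc (0 : ℝ) 1, ∀ x, x ⬝ᵥ M₀ *ᵥ x ≤ x ⬝ᵥ M t *ᵥ x := by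
    intro t ht x
    have := (hMge t ht).dotProduct_mulVec_nonneg x
    rw [star_trivial, sub_mulVec, dotProduct_sub] at this
    linarith
  have hMsymm : ∀ t, (M t).IsSymm := fun t => by
    rw [hM]
    exact ((hA₀.smul _).add (hAh.smul _)).neg
  have hMquad : ∀ t x, x ⬝ᵥ M t *ᵥ x =
      -((α t + β t) * (x ⬝ᵥ A₀ *ᵥ x) + β t * (x ⬝ᵥ Ah *ᵥ x)) := fun t x => by
    simp only [hM, neg_mulVec, add_mulVec, smul_mulVec, dotProduct_neg, dotProduct_add,
      dotProduct_smul, smul_eq_mul]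
  have hderiv : ∀ t ∈ Icc (0 : ℝ) 1, HasDerivWithinAt (fun y => xt y ⬝ᵥ M y *ᵥ xt y)
      (-((M t *ᵥ xt t) ⬝ᵥ Q *ᵥ (M t *ᵥ xt t))) (Icc 0 1) t := by
    intro t ht
    simp only [hMquad]
    refine HasDerivWithinAt.congr_deriv ((((hα t ht).add (hβ t ht)).mul (hA₀.hasDerivWithinAt_quadForm (hxt t ht))).add
      ((hβ t ht).mul (hAh.hasDerivWithinAt_quadForm (hxt t ht)))).neg ?_
    have hMF : (M t *ᵥ xt t) ⬝ᵥ F t *ᵥ xt t =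
        -((α t + β t) * (A₀ *ᵥ xt t ⬝ᵥ F t *ᵥ xt t) + β t * (Ah *ᵥ xt t ⬝ᵥ F t *ᵥ xt t)) := by
      simp only [hM, neg_mulVec, add_mulVec, smul_mulVec, neg_dotProduct, add_dotProduct,
        smul_dotProduct, smul_eq_mul]
    have hinv : (M t *ᵥ xt t) ⬝ᵥ (M t)⁻¹ *ᵥ (Ah *ᵥ xt t) = xt t ⬝ᵥ Ah *ᵥ xt t := by
      rw [(hMsymm t).mulVec_dotProduct, mulVec_mulVec,
        mul_nonsing_inv _ ((isUnit_iff_isUnit_det _).1 (hMinv t ht)), one_mulVec]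
    have hFquad : (M t *ᵥ xt t) ⬝ᵥ F t *ᵥ xt t =
        -(1 / 2) * ((M t *ᵥ xt t) ⬝ᵥ Q *ᵥ (M t *ᵥ xt t))
        + ((α t * β' t - α' t * β t) / (2 * (α t + β t))) * (xt t ⬝ᵥ Ah *ᵥ xt t)
        - ((α' t + β' t) / (2 * (α t + β t))) * (xt t ⬝ᵥ M t *ᵥ xt t) := by
      rw [hF, sub_mulVec, add_mulVec, smul_mulVec, smul_mulVec, smul_mulVec, ← mulVec_mulVec,
        ← mulVec_mulVec, one_mulVec, dotProduct_sub, dotProduct_add, dotProduct_smul,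
        dotProduct_smul, dotProduct_smul, hinv, dotProduct_comm _ (xt t)]
      simp only [smul_eq_mul]
    rw [hMquad, hMF] at hFquad
    have hs := hαβ t ht
    rw [Pi.add_apply]
    generalize (M t *ᵥ xt t) ⬝ᵥ Q *ᵥ (M t *ᵥ xt t) = q at *
    generalize A₀ *ᵥ xt t ⬝ᵥ F t *ᵥ xt t = p₀ at *
    generalize Ah *ᵥ xt t ⬝ᵥ F t *ᵥ xt t = p₁ at *
    generalize xt t ⬝ᵥ A₀ *ᵥ xt t = a at *
    generalize xt t ⬝ᵥ Ah *ᵥ xt t = b at *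
    have : -(1 / 2) * q = -((α t + β t) * p₀ + β t * p₁)
        - (α' t + β' t) * a / 2 - β' t * b / 2 := by
      rw [hFquad]
      field_simp
      ring
    linarith
  have hle : ∀ t ∈ Icc (0 : ℝ) 1, -((M t *ᵥ xt t) ⬝ᵥ Q *ᵥ (M t *ᵥ xt t)) ≤
      -r * (xt t ⬝ᵥ M t *ᵥ xt t) := by
    intro t ht
    have hQ := hQpd.1.iInf_eigenvalues_mul_le (M t *ᵥ xt t)
    have hMM := mul_dotProduct_mulVec_le hm
      ((hM₀.1.iInf_eigenvalues_mul_le (xt t)).trans (hM₀le t ht (xt t)))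
    have := mul_le_mul_of_nonneg_left hMM hq.le
    rw [hr]
    linarith
  have h := le_mul_exp_of_hasDerivWithinAt_le hderiv hle hl
  rw [hc, ← hxt0]
  exact (hM₀le l hl (xt l)).trans h
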